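/- arXiv:2205.08962 — 4 statements merged into one kernel-verified Lean document; each statement's English description precedes it below -/
import Mathlib

section
/- Let n ≥ 2 and let α ∈ ℕ^n with α ≠ 0 and α ≠ ε₁. Then there exist indices 1 ≤ i < j ≤ n and an element θ ∈ Λ with θ_i ≥ 1 such that θ − ε_i + ε_j belongs to Λ but θ + ε_j does not belong to Λ. -/
/-- Graded co-lexicographic order on multi-indices. -/
def gclex {n : ℕ} (β α : Fin n → ℕ) : Prop :=
  (∑ i, β i) < ∑ i, α i ∨
    ((∑ i, β i) = ∑ i, α i ∧
      (β = α ∨ ∃ j, β j < α j ∧ ∀ k, j < k → β k = α k))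

instance {n : ℕ} (β α : Fin n → ℕ) : Decidable (gclex β α) := by
  unfold gclex; infer_instance

/-- `Λ = {β : β ≤ α}` in the graded co-lexicographic order. -/
def Lam {n : ℕ} (α : Fin n → ℕ) : Type := {β : Fin n → ℕ // gclex β α}

lemma gclex_sum_le {n : ℕ} {β α : Fin n → ℕ} (h : gclex β α) :
    (∑ i, β i) ≤ ∑ i, α i := by
  rcases h with h | ⟨h, _⟩
  · exact le_of_lt h
  · exact le_of_eq h

noncomputable instance {n : ℕ} (α : Fin n → ℕ) : Fintype (Lam α) :=
  Fintype.ofInjective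
    (fun β : Lam α => fun i => (⟨β.1 i, by
      have h1 : β.1 i ≤ ∑ j, β.1 j :=
        Finset.single_le_sum (fun j _ => Nat.zero_le _) (Finset.mem_univ i)
      have h2 := gclex_sum_le β.2
      omega⟩ : Fin (∑ i, α i + 1)))
    (fun a b hab => Subtype.ext (funext fun i => congrArg Fin.val (congrFun hab i)))

instance {n : ℕ} (α : Fin n → ℕ) : DecidableEq (Lam α) :=
  fun a b => decidable_of_iff (a.1 = b.1) Subtype.ext_iff.symm


lemma sum_add_single_one {n : ℕ} (β : Fin n → ℕ) (j : Fin n) :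
    ∑ k, (β + Pi.single j 1 : Fin n → ℕ) k = ∑ k, β k + 1 := by
  simp [Finset.sum_add_distrib]

lemma gclex_add_single_of_lt {n : ℕ} (γ : Fin n → ℕ) {i j : Fin n} (hij : i < j) :
    gclex (γ + Pi.single i 1) (γ + Pi.single j 1) := by
  refine Or.inr ⟨by rw [sum_add_single_one, sum_add_single_one], Or.inr ⟨j, ?_, ?_⟩⟩
  · simp [hij.ne']
  · intro k hk
    simp [hk.ne', (hij.trans hk).ne']

lemma not_gclex_add_single_of_lt {n : ℕ} (γ : Fin n → ℕ) {i j : Fin n} (hij : i < j) :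
    ¬ gclex (γ + Pi.single j 1) (γ + Pi.single i 1) := by
  rintro (h | ⟨-, h | ⟨k, hk, hgt⟩⟩)
  · rw [sum_add_single_one, sum_add_single_one] at h
    exact lt_irrefl _ h
  · have := congrFun h j
    simp [hij.ne'] at this
  · rcases lt_or_ge k j with hkj | hjk
    · have := hgt j hkj
      simp [hij.ne'] at this
    · simp [(hij.trans_le hjk).ne'] at hk

/-- If `n ≥ 2`, `α ≠ 0` and `α ≠ ε₁`, then there are indices `i < j`
and `θ ∈ Λ` with `θᵢ ≥ 1` such that `θ - εᵢ + εⱼ ∈ Λ` but `θ + εⱼ ∉ Λ`. -/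
theorem stmt_0 {n : ℕ} (hn : 2 ≤ n) (α : Fin n → ℕ) (hα0 : α ≠ 0)
    (hα1 : α ≠ Pi.single (⟨0, by omega⟩ : Fin n) 1) :
    ∃ i j : Fin n, i < j ∧ ∃ θ : Fin n → ℕ, gclex θ α ∧ 1 ≤ θ i ∧
      gclex (θ - Pi.single i 1 + Pi.single j 1) α ∧
      ¬ gclex (θ + Pi.single j 1) α := by
  set z : Fin n := ⟨0, by omega⟩ with hz
  by_cases h : ∃ j, z < j ∧ 1 ≤ α j
  · obtain ⟨j, hzj, hj⟩ := h
    obtain ⟨γ, rfl⟩ : ∃ γ : Fin n → ℕ, α = γ + Pi.single j 1 := by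
      refine ⟨α - Pi.single j 1, (tsub_add_cancel_of_le ?_).symm⟩
      intro k
      by_cases hk : k = j
      · subst hk; simpa using hj
      · simp [hk]
    refine ⟨z, j, hzj, γ + Pi.single z 1, gclex_add_single_of_lt γ hzj, by simp, ?_, ?_⟩
    · rw [add_tsub_cancel_right]
      exact Or.inr ⟨rfl, Or.inl rfl⟩
    · intro hle
      have := gclex_sum_le hle
      simp only [sum_add_single_one] at this
      omega
  · push Not at h
    have hα : α = Pi.single z (α z) := by
      funext k
      by_cases hk : k = z
      · subst hk; simp
      · have hzk : z < k := by
          rw [Fin.lt_def]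
          have := Fin.val_ne_of_ne hk
          simp only [hz] at this ⊢
          omega
        have := h k hzk
        simp only [Pi.single_eq_of_ne hk]
        omega
    obtain ⟨m, hm⟩ : ∃ m, α z = m + 2 := by
      rcases hc : α z with _ | _ | m
      · exact absurd (by rw [hα, hc, Pi.single_zero]) hα0
      · exact absurd (by rw [hα, hc]) hα1
      · exact ⟨m, rfl⟩
    have hα' : α = Pi.single z m + Pi.single z 1 + Pi.single z 1 := by
      rw [hα, hm, ← Pi.single_add, ← Pi.single_add]
    subst hα'
    have hzj : z < ⟨1, by omega⟩ := by simp [hz, Fin.lt_def]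
    refine ⟨z, ⟨1, by omega⟩, hzj, Pi.single z m + Pi.single z 1, Or.inl ?_, by simp,
      Or.inl ?_, not_gclex_add_single_of_lt _ hzj⟩
    · simp only [sum_add_single_one]
      omega
    · rw [add_tsub_cancel_right]
      simp only [sum_add_single_one]
      omega
end

section
/- Fix 1 ≤ i ≤ n, λ ∈ ℝ, and a function b : Λ → (0,∞); let B be the Λ×Λ diagonal matrix with (B)_{θθ} = b_θ. Then the Λ×Λ real matrix λ·I + 2D_i − S̃_iᵀ B⁻¹ S̃_i B + B⁻¹ S̃_i B S̃_iᵀ is diagonal, and its θ-th diagonal entry equals λ + 2θ_i − t₁(θ) + t₂(θ), where t₁(θ) = (θ_i+1)² b_θ / b_{θ+ε_i} if θ + ε_i ∈ Λ and t₁(θ) = 0 otherwise, and t₂(θ) = θ_i² b_{θ−ε_i} / b_θ if θ_i ≥ 1 and t₂(θ) = 0 otherwise. (Here S̃_iᵀ is the transpose of S̃_i.) -/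
open Matrix

/-- The weighted shift `S̃ᵢ` on `ℝ^Λ`, as a `Λ × Λ` matrix:
`S̃ᵢ e_θ = (θᵢ + 1) e_{θ + εᵢ}` if `θ + εᵢ ∈ Λ`, and `0` otherwise. -/
def StildeR {n : ℕ} (α : Fin n → ℕ) (i : Fin n) :
    Matrix (Lam α) (Lam α) ℝ :=
  Matrix.of fun η θ : Lam α =>
    if η.1 = θ.1 + Pi.single i 1 then ((θ.1 i : ℝ) + 1) else 0

/-- The diagonal matrix `Dᵢ` with `(Dᵢ)_{θθ} = θᵢ`. -/
def DiR {n : ℕ} (α : Fin n → ℕ) (i : Fin n) : Matrix (Lam α) (Lam α) ℝ :=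
  Matrix.diagonal fun θ : Lam α => (θ.1 i : ℝ)

theorem gclex_sub_single {n : ℕ} {θ α : Fin n → ℕ} (h : gclex θ α) {i : Fin n}
    (hi : 1 ≤ θ i) : gclex (θ - Pi.single i 1) α := by
  refine Or.inl (lt_of_lt_of_le (Finset.sum_lt_sum (fun j _ => ?_) ⟨i, Finset.mem_univ i, ?_⟩)
    (gclex_sum_le h))
  · exact Nat.sub_le _ _
  · simp only [Pi.sub_apply, Pi.single_eq_same]
    omega

theorem StildeR_apply {n : ℕ} (α : Fin n → ℕ) (i : Fin n) (η θ : Lam α) :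
    StildeR α i η θ = if η.1 = θ.1 + Pi.single i 1 then ((θ.1 i : ℝ) + 1) else 0 :=
  rfl

theorem StildeR_transpose_mul_diagonal_mul {n : ℕ} (α : Fin n → ℕ) (i : Fin n)
    (d : (Fin n → ℕ) → ℝ) :
    (StildeR α i)ᵀ * Matrix.diagonal (fun θ : Lam α => d θ.1) * StildeR α i
      = Matrix.diagonal fun θ : Lam α =>
          if gclex (θ.1 + Pi.single i 1) α then
            ((θ.1 i : ℝ) + 1) ^ 2 * d (θ.1 + Pi.single i 1) else 0 := by
  ext θ η
  rw [Matrix.mul_apply, Matrix.diagonal_apply]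
  simp only [Matrix.mul_diagonal, Matrix.transpose_apply, StildeR_apply]
  by_cases h : gclex (θ.1 + Pi.single i 1) α
  · refine (Finset.sum_eq_single (⟨θ.1 + Pi.single i 1, h⟩ : Lam α) ?_ ?_).trans ?_
    · intro κ _ hκ
      rw [if_neg fun e => hκ (Subtype.ext e)]
      simp
    · exact fun hu => absurd (Finset.mem_univ (α := Lam α) _) hu
    · by_cases e : θ = η
      · subst e
        simp only [h, if_true]
        ring
      · have e' : θ.1 ≠ η.1 := fun h => e (Subtype.ext h)
        simp [e, e']
  · refine (Finset.sum_eq_zero ?_).trans ?_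
    · intro κ _
      have hκ : κ.1 ≠ θ.1 + Pi.single i 1 := fun e => h (e ▸ κ.2)
      rw [if_neg hκ]
      simp
    · simp [h]

theorem StildeR_mul_diagonal_mul_transpose {n : ℕ} (α : Fin n → ℕ) (i : Fin n)
    (d : (Fin n → ℕ) → ℝ) :
    StildeR α i * Matrix.diagonal (fun θ : Lam α => d θ.1) * (StildeR α i)ᵀ
      = Matrix.diagonal fun θ : Lam α =>
          if 1 ≤ θ.1 i then (θ.1 i : ℝ) ^ 2 * d (θ.1 - Pi.single i 1) else 0 := by
  ext θ η
  rw [Matrix.mul_apply, Matrix.diagonal_apply]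
  simp only [Matrix.mul_diagonal, Matrix.transpose_apply, StildeR_apply]
  by_cases h : 1 ≤ θ.1 i
  · have hθ : θ.1 = θ.1 - Pi.single i 1 + Pi.single i 1 := by
      refine (tsub_add_cancel_of_le fun j => ?_).symm
      by_cases hj : j = i
      · subst hj
        simpa using h
      · simp [hj]
    refine (Finset.sum_eq_single
      (⟨θ.1 - Pi.single i 1, gclex_sub_single θ.2 h⟩ : Lam α) ?_ ?_).trans ?_
    · intro κ _ hκ
      rw [if_neg fun e => hκ (Subtype.ext (by simp [e]))]
      simp
    · exact fun hu => absurd (Finset.mem_univ (α := Lam α) _) hu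
    · dsimp only
      rw [← hθ]
      by_cases e : θ = η
      · subst e
        simp only [h, if_true, Pi.sub_apply, Pi.single_eq_same, Nat.cast_sub h, Nat.cast_one]
        ring
      · have e' : η.1 ≠ θ.1 := fun h => e (Subtype.ext h.symm)
        simp [e, e']
  · refine (Finset.sum_eq_zero ?_).trans ?_
    · intro κ _
      rw [if_neg fun e => h (by simp [e])]
      simp
    · simp [h]

/-- For `B = diag(b)` with `b > 0` on `Λ`, the matrix
`λ·I + 2Dᵢ - S̃ᵢᵀ B⁻¹ S̃ᵢ B + B⁻¹ S̃ᵢ B S̃ᵢᵀ` is diagonal with `θ`-entry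
`λ + 2θᵢ - t₁(θ) + t₂(θ)`, where `t₁(θ) = (θᵢ+1)² b_θ / b_{θ+εᵢ}` if `θ + εᵢ ∈ Λ`
(`0` otherwise) and `t₂(θ) = θᵢ² b_{θ-εᵢ} / b_θ` if `θᵢ ≥ 1` (`0` otherwise). -/
theorem stmt_3 {n : ℕ} (α : Fin n → ℕ) (i : Fin n) (lam : ℝ)
    (b : (Fin n → ℕ) → ℝ) (hb : ∀ θ, gclex θ α → 0 < b θ) :
    lam • (1 : Matrix (Lam α) (Lam α) ℝ) + 2 • DiR α i
        - (StildeR α i)ᵀ * (Matrix.diagonal fun θ : Lam α => b θ.1)⁻¹ * StildeR α i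
            * (Matrix.diagonal fun θ : Lam α => b θ.1)
        + (Matrix.diagonal fun θ : Lam α => b θ.1)⁻¹ * StildeR α i
            * (Matrix.diagonal fun θ : Lam α => b θ.1) * (StildeR α i)ᵀ
      = Matrix.diagonal (fun θ : Lam α =>
          lam + 2 * (θ.1 i : ℝ)
            - (if gclex (θ.1 + Pi.single i 1) α then
                 ((θ.1 i : ℝ) + 1) ^ 2 * b θ.1 / b (θ.1 + Pi.single i 1)
               else 0)
            + (if 1 ≤ θ.1 i then
                 (θ.1 i : ℝ) ^ 2 * b (θ.1 - Pi.single i 1) / b θ.1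
               else 0)) := by
  have hinv : (Matrix.diagonal fun θ : Lam α => b θ.1)⁻¹
      = Matrix.diagonal fun θ : Lam α => (b θ.1)⁻¹ := by
    refine Matrix.inv_eq_left_inv ?_
    rw [Matrix.diagonal_mul_diagonal, ← Matrix.diagonal_one]
    exact congrArg _ (funext fun θ => inv_mul_cancel₀ (hb θ.1 θ.2).ne')
  rw [hinv, StildeR_transpose_mul_diagonal_mul α i fun θ => (b θ)⁻¹,
    Matrix.mul_assoc (Matrix.diagonal _) (StildeR α i), Matrix.mul_assoc (Matrix.diagonal _),
    StildeR_mul_diagonal_mul_transpose α i b, Matrix.diagonal_mul_diagonal,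
    Matrix.diagonal_mul_diagonal, DiR, two_nsmul]
  ext θ η
  by_cases e : θ = η
  · subst e
    simp only [Matrix.add_apply, Matrix.sub_apply, Matrix.smul_apply, Matrix.one_apply_eq,
      Matrix.diagonal_apply_eq, smul_eq_mul, mul_one]
    split_ifs <;> ring
  · simp [e]
end

section
/- Let Φ be a Λ×Λ complex matrix such that Φ commutes with D_i and with S̃_i for every 1 ≤ i ≤ n. Then Φ is a scalar matrix: there exists c ∈ ℂ with Φ = c·I. -/
/-- The weighted shift `S̃ᵢ` on `ℂ^Λ`, as a `Λ × Λ` matrix: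
`S̃ᵢ e_θ = (θᵢ + 1) e_{θ + εᵢ}` if `θ + εᵢ ∈ Λ`, and `0` otherwise. -/
noncomputable def Stilde {n : ℕ} (α : Fin n → ℕ) (i : Fin n) :
    Matrix (Lam α) (Lam α) ℂ :=
  Matrix.of fun η θ : Lam α =>
    if η.1 = θ.1 + Pi.single i 1 then ((θ.1 i : ℂ) + 1) else 0

/-- The diagonal matrix `Dᵢ` on `ℂ^Λ` with `(Dᵢ)_{θθ} = θᵢ`. -/
noncomputable def Di {n : ℕ} (α : Fin n → ℕ) (i : Fin n) :
    Matrix (Lam α) (Lam α) ℂ :=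
  Matrix.diagonal fun θ : Lam α => (θ.1 i : ℂ)

lemma gclex_zero {n : ℕ} (α : Fin n → ℕ) : gclex 0 α := by
  rcases Nat.eq_zero_or_pos (∑ i, α i) with h | h
  · refine Or.inr ⟨by simp [h], Or.inl (funext fun i => ?_)⟩
    exact ((Finset.sum_eq_zero_iff.1 h) i (Finset.mem_univ i)).symm
  · exact Or.inl (by simpa using h)

lemma gclex_of_add_single {n : ℕ} {α θ : Fin n → ℕ} {i : Fin n}
    (h : gclex (θ + Pi.single i 1) α) : gclex θ α := by
  have h1 := gclex_sum_le h
  simp only [Pi.add_apply, Finset.sum_add_distrib, Fintype.sum_pi_single'] at h1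
  exact Or.inl (by omega)

lemma exists_eq_add_single {n : ℕ} {η : Fin n → ℕ} (h : η ≠ 0) :
    ∃ (i : Fin n) (θ : Fin n → ℕ), η = θ + Pi.single i 1 := by
  obtain ⟨i, hi⟩ := Function.ne_iff.1 h
  refine ⟨i, η - Pi.single i 1, (tsub_add_cancel_of_le ?_).symm⟩
  intro j
  rcases eq_or_ne j i with rfl | hj
  · simpa using Nat.one_le_iff_ne_zero.2 hi
  · simp [hj]

/-- A matrix commuting with every `Dᵢ` has vanishing off-diagonal entries. -/
lemma apply_eq_zero_of_commute_Di {n : ℕ} {α : Fin n → ℕ} {Φ : Matrix (Lam α) (Lam α) ℂ}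
    (hD : ∀ i, Φ * Di α i = Di α i * Φ) {η θ : Lam α} (h : η ≠ θ) : Φ η θ = 0 := by
  obtain ⟨i, hi⟩ := Function.ne_iff.1 (fun e => h (Subtype.ext e) : η.1 ≠ θ.1)
  have h1 := congrFun (congrFun (hD i) η) θ
  rw [Di, Matrix.mul_diagonal, Matrix.diagonal_mul, mul_comm, ← sub_eq_zero, ← sub_mul] at h1
  refine (mul_eq_zero.1 h1).resolve_left (sub_ne_zero.2 ?_)
  exact_mod_cast hi.symm

/-- The diagonal entries of a matrix commuting with every `Dᵢ` and `S̃ᵢ` agree along shifts. -/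
lemma apply_self_eq_of_eq_add_single {n : ℕ} {α : Fin n → ℕ} {Φ : Matrix (Lam α) (Lam α) ℂ}
    (hD : ∀ i, Φ * Di α i = Di α i * Φ) {i : Fin n}
    (hS : Φ * Stilde α i = Stilde α i * Φ) {η θ : Lam α}
    (h : η.1 = θ.1 + Pi.single i 1) : Φ η η = Φ θ θ := by
  have h1 := congrFun (congrFun hS η) θ
  rw [Matrix.mul_apply, Matrix.mul_apply,
    Finset.sum_eq_single η
      (fun ζ _ hζ => by rw [apply_eq_zero_of_commute_Di hD hζ.symm, zero_mul]) (by simp),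
    Finset.sum_eq_single θ
      (fun ζ _ hζ => by rw [apply_eq_zero_of_commute_Di hD hζ, mul_zero]) (by simp)] at h1
  simp only [Stilde, Matrix.of_apply, if_pos h] at h1
  rw [mul_comm] at h1
  exact mul_left_cancel₀ (Nat.cast_add_one_ne_zero _) h1

/-- If a `Λ × Λ` complex matrix `Φ` commutes with every `Dᵢ` and with
every `S̃ᵢ`, then `Φ` is a scalar matrix. -/
theorem stmt_6 {n : ℕ} (α : Fin n → ℕ) (Φ : Matrix (Lam α) (Lam α) ℂ)
    (hD : ∀ i, Φ * Di α i = Di α i * Φ)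
    (hS : ∀ i, Φ * Stilde α i = Stilde α i * Φ) :
    ∃ c : ℂ, Φ = c • (1 : Matrix (Lam α) (Lam α) ℂ) := by
  have key : ∀ (m : ℕ) (η : Lam α), ∑ i, η.1 i = m →
      Φ η η = Φ ⟨0, gclex_zero α⟩ ⟨0, gclex_zero α⟩ := by
    intro m
    induction m with
    | zero =>
      intro η hη
      have h0 : η = ⟨0, gclex_zero α⟩ :=
        Subtype.ext (funext fun i => Finset.sum_eq_zero_iff.1 hη i (Finset.mem_univ i))
      rw [h0]
    | succ m ih =>
      intro η hη
      have hne : η.1 ≠ 0 := fun h => by simp [h] at hη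
      obtain ⟨i, θ, h⟩ := exists_eq_add_single hne
      rw [apply_self_eq_of_eq_add_single (θ := ⟨θ, gclex_of_add_single (h ▸ η.2)⟩) hD (hS i) h]
      refine ih _ ?_
      simp only [h, Pi.add_apply, Finset.sum_add_distrib, Fintype.sum_pi_single'] at hη
      exact Nat.succ_injective hη
  refine ⟨Φ ⟨0, gclex_zero α⟩ ⟨0, gclex_zero α⟩, Matrix.ext fun η θ => ?_⟩
  rcases eq_or_ne η θ with rfl | h
  · simp [key _ η rfl]
  · simp [apply_eq_zero_of_commute_Di hD h, h]
end

section
/- For λ ∈ (0,∞)^n, let L(λ) be the Λ×Λ real matrix whose (θ,β) entry equals ∏_{i=1}^n C(θ_i,β_i)² (θ_i−β_i)! / ((λ_i+2β_i)(λ_i+2β_i+1)⋯(λ_i+2β_i+θ_i−β_i−1)) when β ≤ θ componentwise (each empty product in the denominator being 1), and equals 0 otherwise. Then for every λ ∈ (0,∞)^n and every μ : Λ → (0,∞), there exists ε ∈ ℝ^n with 0 < ε_i < λ_i for all i such that L(λ−ε) is invertible and every entry of the vector L(λ−ε)⁻¹ · (L(λ) · μ²) is strictly positive, where μ² denotes the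 vector (μ_β²)_{β∈Λ}. -/
open Matrix

/-- The `Λ × Λ` matrix `L(λ)` with `(θ, β)` entry
`∏ᵢ C(θᵢ, βᵢ)² (θᵢ - βᵢ)! / (λᵢ + 2βᵢ)_{θᵢ - βᵢ}` when `β ≤ θ` componentwise,
and `0` otherwise. -/
noncomputable def Lmat {n : ℕ} (α : Fin n → ℕ) (lam : Fin n → ℝ) :
    Matrix (Lam α) (Lam α) ℝ :=
  Matrix.of fun θ β : Lam α =>
    if ∀ i, β.1 i ≤ θ.1 i then
      ∏ i, ((θ.1 i).choose (β.1 i) : ℝ) ^ 2 * ((θ.1 i - β.1 i).factorial : ℝ)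
        / (ascPochhammer ℝ (θ.1 i - β.1 i)).eval (lam i + 2 * (β.1 i : ℝ))
    else 0

lemma Lmat_apply_self {n : ℕ} (α : Fin n → ℕ) (lam : Fin n → ℝ) (θ : Lam α) :
    Lmat α lam θ θ = 1 := by
  simp [Lmat]

/-- `L(λ)` is unipotent for the componentwise order, so it is invertible for every real `λ`. -/
lemma isUnit_Lmat {n : ℕ} (α : Fin n → ℕ) (lam : Fin n → ℝ) : IsUnit (Lmat α lam) := by
  rw [← Matrix.mulVec_injective_iff_isUnit, ← Matrix.coe_mulVecLin,
    injective_iff_map_eq_zero]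
  intro v hv
  have key : ∀ (N : ℕ) (θ : Lam α), ∑ i, θ.1 i = N → v θ = 0 := by
    intro N
    induction N using Nat.strong_induction_on with
    | _ N ih =>
      intro θ hθ
      have hrow : ∑ β, Lmat α lam θ β * v β = 0 := congrFun hv θ
      rw [Finset.sum_eq_single θ, Lmat_apply_self, one_mul] at hrow
      · exact hrow
      · intro β _ hne
        by_cases hle : ∀ i, β.1 i ≤ θ.1 i
        · have hlt : β.1 < θ.1 := lt_of_le_of_ne hle fun h => hne (Subtype.ext h)
          have hsum : ∑ i, β.1 i < N := by
            obtain ⟨j, hj⟩ := (Pi.lt_def.1 hlt).2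
            exact hθ ▸ Finset.sum_lt_sum (fun i _ => hle i) ⟨j, Finset.mem_univ j, hj⟩
          rw [ih _ hsum β rfl, mul_zero]
        · simp [Lmat, hle]
      · simp
  exact funext fun θ => key _ θ rfl

lemma continuousAt_Lmat {n : ℕ} (α : Fin n → ℕ) (lam : Fin n → ℝ) (hlam : ∀ i, 0 < lam i) :
    ContinuousAt (Lmat α) lam := by
  refine continuousAt_pi.2 fun θ => continuousAt_pi.2 fun β => ?_
  by_cases hle : ∀ i, β.1 i ≤ θ.1 i
  · simp only [Lmat, Matrix.of_apply, if_pos hle]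
    refine tendsto_finsetProd _ fun i _ => ?_
    refine ContinuousAt.div continuousAt_const ?_ ?_
    · exact ((Polynomial.continuous _).comp (by fun_prop)).continuousAt
    · have := hlam i
      exact (ascPochhammer_pos _ _ (by positivity)).ne'
  · simp only [Lmat, Matrix.of_apply, if_neg hle]
    exact continuousAt_const

/-- For every `λ ∈ (0, ∞)ⁿ` and `μ : Λ → (0, ∞)` there is `ε` with
`0 < εᵢ < λᵢ` for all `i`, such that `L(λ - ε)` is invertible and every entry of
`L(λ - ε)⁻¹ ⬝ (L(λ) ⬝ μ²)` is strictly positive. -/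
theorem stmt_9 {n : ℕ} (α : Fin n → ℕ) (lam : Fin n → ℝ) (hlam : ∀ i, 0 < lam i)
    (μ : Lam α → ℝ) (hμ : ∀ θ, 0 < μ θ) :
    ∃ ε : Fin n → ℝ, (∀ i, 0 < ε i ∧ ε i < lam i) ∧
      IsUnit (Lmat α (lam - ε)) ∧
      ∀ θ : Lam α,
        0 < ((Lmat α (lam - ε))⁻¹ *ᵥ (Lmat α lam *ᵥ fun β : Lam α => μ β ^ 2)) θ := by
  have hcont : ContinuousAt
      (fun t : ℝ => (Lmat α (lam - fun _ => t))⁻¹ *ᵥ (Lmat α lam *ᵥ fun β : Lam α => μ β ^ 2))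
      0 := by
    have hL : ContinuousAt (fun t : ℝ => Lmat α (lam - fun _ => t)) 0 :=
      ContinuousAt.comp (g := Lmat α) (continuousAt_Lmat α _ (by simpa using hlam))
        (by fun_prop : Continuous fun t : ℝ => lam - fun _ : Fin n => t).continuousAt
    have hdet : (Lmat α (lam - fun _ => (0 : ℝ))).det ≠ 0 :=
      ((Matrix.isUnit_iff_isUnit_det _).1 (isUnit_Lmat α _)).ne_zero
    have hinv : ContinuousAt (fun t : ℝ => (Lmat α (lam - fun _ => t))⁻¹) 0 := by
      simp only [Matrix.inv_def, Ring.inverse_eq_inv']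
      exact ContinuousAt.smul
        (((Continuous.matrix_det continuous_id).continuousAt.comp hL).inv₀ hdet)
        ((Continuous.matrix_adjugate continuous_id).continuousAt.comp hL)
    exact (Continuous.matrix_mulVec continuous_id continuous_const).continuousAt.comp hinv
  have hzero : (Lmat α (lam - fun _ => (0 : ℝ)))⁻¹ *ᵥ
      (Lmat α lam *ᵥ fun β : Lam α => μ β ^ 2) = fun β => μ β ^ 2 := by
    have h0 : (lam - fun _ => (0 : ℝ)) = lam := sub_zero lam
    rw [h0, Matrix.mulVec_mulVec,
      Matrix.nonsing_inv_mul _ ((Matrix.isUnit_iff_isUnit_det _).1 (isUnit_Lmat α lam)),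
      Matrix.one_mulVec]
  have hpos : ∀ᶠ t : ℝ in nhdsWithin 0 (Set.Ioi 0), ∀ θ : Lam α,
      0 < ((Lmat α (lam - fun _ => t))⁻¹ *ᵥ
        (Lmat α lam *ᵥ fun β : Lam α => μ β ^ 2)) θ := by
    refine Filter.eventually_all.2 fun θ => nhdsWithin_le_nhds ?_
    refine (continuousAt_pi.1 hcont θ).eventually_const_lt ?_
    simp only [hzero]
    exact pow_pos (hμ θ) 2
  have hlt : ∀ᶠ t : ℝ in nhdsWithin 0 (Set.Ioi 0), ∀ i, t < lam i :=
    Filter.eventually_all.2 fun i => nhdsWithin_le_nhds (eventually_lt_nhds (hlam i))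
  obtain ⟨t, ⟨hp, hl⟩, ht⟩ := ((hpos.and hlt).and self_mem_nhdsWithin).exists
  exact ⟨fun _ => t, fun i => ⟨ht, hl i⟩, isUnit_Lmat α _, hp⟩
end
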